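/- arXiv:1707.06110 — 5 statements merged into one kernel-verified Lean document; each statement's English description precedes it below -/
import Mathlib

section
/- For every integer n ≥ 2 and every permutation τ of {1,…,n−1}, there is exactly one unordered pair {π, σ} of distinct permutations of {1,…,n} that are twins and whose signature is τ (i.e., red(π₁⋯π_{n−1}) = red(σ₁⋯σ_{n−1}) = τ). -/
/-- `w` is order-isomorphic to the permutation `τ`, i.e. `red w = τ`:
`red(w)_i < red(w)_j` iff `w_i < w_j`. -/
def IsRed {m k : ℕ} (w : Fin m → Fin k) (τ : Equiv.Perm (Fin m)) : Prop :=
  ∀ i j : Fin m, w i < w j ↔ τ i < τ j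

/-- Two permutations of `{1,…,n}` (here `n = m+2`) are twins: they are distinct,
their length-`(n-1)` prefixes are order-isomorphic (have the same reduction), and
in each of them the last and the first elements differ by exactly `1`. -/
def Twins {m : ℕ} (π σ : Equiv.Perm (Fin (m + 2))) : Prop :=
  π ≠ σ ∧
  (∀ i j : Fin (m + 1), π i.castSucc < π j.castSucc ↔ σ i.castSucc < σ j.castSucc) ∧
  (((π (Fin.last (m + 1)) : ℕ) : ℤ) - ((π 0 : ℕ) : ℤ)).natAbs = 1 ∧
  (((σ (Fin.last (m + 1)) : ℕ) : ℤ) - ((σ 0 : ℕ) : ℤ)).natAbs = 1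

/-- The permutation in the cluster of `τ` whose last entry is `p`. -/
def clusterPerm {m : ℕ} (τ : Equiv.Perm (Fin (m + 1))) (p : Fin (m + 2)) :
    Equiv.Perm (Fin (m + 2)) :=
  (finSuccEquivLast.trans τ.optionCongr).trans (finSuccEquiv' p).symm

@[simp]
theorem clusterPerm_castSucc {m : ℕ} (τ : Equiv.Perm (Fin (m + 1))) (p : Fin (m + 2))
    (i : Fin (m + 1)) : clusterPerm τ p i.castSucc = p.succAbove (τ i) := by
  simp [clusterPerm]

@[simp]
theorem clusterPerm_last {m : ℕ} (τ : Equiv.Perm (Fin (m + 1))) (p : Fin (m + 2)) :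
    clusterPerm τ p (Fin.last (m + 1)) = p := by
  simp [clusterPerm]

theorem isRed_clusterPerm {m : ℕ} (τ : Equiv.Perm (Fin (m + 1))) (p : Fin (m + 2)) :
    IsRed (fun i : Fin (m + 1) => clusterPerm τ p i.castSucc) τ := by
  intro i j
  simp

/-- A permutation with signature `τ` is determined by its last entry. -/
theorem eq_clusterPerm_of_isRed {m : ℕ} {τ : Equiv.Perm (Fin (m + 1))}
    {π : Equiv.Perm (Fin (m + 2))} (h : IsRed (fun i : Fin (m + 1) => π i.castSucc) τ) :
    π = clusterPerm τ (π (Fin.last (m + 1))) := by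
  have key : (fun i => π (τ.symm i).castSucc) = (π (Fin.last (m + 1))).succAbove := by
    refine (StrictMono.range_inj (fun i j hij => (h _ _).2 (by simpa using hij))
      (Fin.strictMono_succAbove _)).1 ?_
    rw [Fin.range_succAbove]
    ext x
    simp only [Set.mem_range, Set.mem_compl_iff, Set.mem_singleton_iff]
    constructor
    · rintro ⟨i, rfl⟩ hi
      exact (Fin.castSucc_lt_last _).ne (π.injective hi)
    · intro hx
      have hne : π.symm x ≠ Fin.last (m + 1) := by
        rintro he
        exact hx (by rw [← he, π.apply_symm_apply])
      obtain ⟨j, hj⟩ := Fin.exists_castSucc_eq.2 hne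
      exact ⟨τ j, by simp [hj]⟩
  ext x
  refine Fin.lastCases ?_ (fun i => ?_) x
  · simp
  · rw [clusterPerm_castSucc, ← key]
    simp

theorem natAbs_sub_clusterPerm_eq_one_iff {m : ℕ} (τ : Equiv.Perm (Fin (m + 1)))
    (p : Fin (m + 2)) :
    (((clusterPerm τ p (Fin.last (m + 1)) : ℕ) : ℤ) -
      ((clusterPerm τ p 0 : ℕ) : ℤ)).natAbs = 1 ↔ p = (τ 0).castSucc ∨ p = (τ 0).succ := by
  rw [clusterPerm_last, ← Fin.castSucc_zero, clusterPerm_castSucc]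
  simp only [Fin.succAbove, Fin.ext_iff, Fin.lt_def, Fin.val_castSucc, Fin.val_succ]
  split_ifs <;> simp only [Fin.val_castSucc, Fin.val_succ] <;> omega

/-- For every `n ≥ 2` (written `n = m+2`) and every permutation `τ` of `{1,…,n-1}`,
there is exactly one unordered pair `{π, σ}` of distinct `n`-permutations that are twins
and whose signature (reduction of the first `n-1` entries) is `τ`. -/
theorem stmt0 (m : ℕ) (τ : Equiv.Perm (Fin (m + 1))) :
    ∃ π σ : Equiv.Perm (Fin (m + 2)),
      (Twins π σ ∧ IsRed (fun i : Fin (m + 1) => π i.castSucc) τ ∧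
        IsRed (fun i : Fin (m + 1) => σ i.castSucc) τ) ∧
      ∀ π' σ' : Equiv.Perm (Fin (m + 2)),
        Twins π' σ' → IsRed (fun i : Fin (m + 1) => π' i.castSucc) τ →
        IsRed (fun i : Fin (m + 1) => σ' i.castSucc) τ →
        ((π' = π ∧ σ' = σ) ∨ (π' = σ ∧ σ' = π)) := by
  refine ⟨clusterPerm τ (τ 0).castSucc, clusterPerm τ (τ 0).succ,
    ⟨⟨fun h => ?_, fun i j => ?_, ?_, ?_⟩, isRed_clusterPerm _ _, isRed_clusterPerm _ _⟩, ?_⟩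
  · have hlast := DFunLike.congr_fun h (Fin.last (m + 1))
    rw [clusterPerm_last, clusterPerm_last] at hlast
    exact Fin.castSucc_lt_succ.ne hlast
  · exact (isRed_clusterPerm τ _ i j).trans (isRed_clusterPerm τ _ i j).symm
  · exact (natAbs_sub_clusterPerm_eq_one_iff τ _).2 (Or.inl rfl)
  · exact (natAbs_sub_clusterPerm_eq_one_iff τ _).2 (Or.inr rfl)
  · rintro π σ ⟨hne, -, hπ, hσ⟩ hπτ hστ
    rw [eq_clusterPerm_of_isRed hπτ, natAbs_sub_clusterPerm_eq_one_iff] at hπ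
    rw [eq_clusterPerm_of_isRed hστ, natAbs_sub_clusterPerm_eq_one_iff] at hσ
    have eπ := eq_clusterPerm_of_isRed hπτ
    have eσ := eq_clusterPerm_of_isRed hστ
    rcases hπ with hπ | hπ <;> rcases hσ with hσ | hσ <;> rw [hπ] at eπ <;> rw [hσ] at eσ
    · exact absurd (eπ.trans eσ.symm) hne
    · exact Or.inl ⟨eπ, eσ⟩
    · exact Or.inr ⟨eπ, eσ⟩
    · exact absurd (eπ.trans eσ.symm) hne
end

section
/- For every integer n ≥ 2 and every permutation τ of {1,…,n−1}, there is exactly one permutation ρ of {1,…,n−1} such that exactly two permutations π of {1,…,n} satisfy red(π₁⋯π_{n−1}) = τ and red(π₂⋯π_n) = ρ; moreover, for no permutation ρ of {1,…,n−1} do three or more permutations π of {1,…,n} satisfy red(π₁⋯π_{n−1}) = τ and red(π₂⋯π_n) = ρ. -/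
/-- Every injective word has a reduction. -/
theorem exists_isRed {m k : ℕ} {w : Fin m → Fin k} (hw : Function.Injective w) :
    ∃ τ : Equiv.Perm (Fin m), IsRed w τ := by
  have hs : StrictMono (w ∘ Tuple.sort w) :=
    (Tuple.monotone_sort w).strictMono_of_injective (hw.comp (Tuple.sort w).injective)
  refine ⟨(Tuple.sort w)⁻¹, fun i j => ?_⟩
  rw [← hs.lt_iff_lt]
  simp

theorem IsRed.strictMono {m k : ℕ} {w : Fin m → Fin k} {τ : Equiv.Perm (Fin m)}
    (h : IsRed w τ) : StrictMono (w ∘ τ.symm) := fun i j hij =>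
  (h _ _).2 (by simpa using hij)

/-- The reduction of a word is unique. -/
theorem IsRed.unique {m k : ℕ} {w : Fin m → Fin k} {τ ρ : Equiv.Perm (Fin m)}
    (h : IsRed w τ) (h' : IsRed w ρ) : τ = ρ := by
  have hw : w ∘ τ.symm = w ∘ ρ.symm := (h.strictMono.range_inj h'.strictMono).1 (by
    rw [τ.symm.surjective.range_comp, ρ.symm.surjective.range_comp])
  have inj : Function.Injective w := by
    intro i j hij
    apply τ.injective
    have h1 := h i j
    have h2 := h j i
    simp only [hij, lt_irrefl, false_iff, not_lt] at h1 h2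
    exact le_antisymm h2 h1
  apply Equiv.symm_bijective.injective
  ext i : 1
  exact inj (congrFun hw i)

/-- The permutation with last value `a` whose prefix reduces to `τ`. -/
noncomputable def snocPerm {m : ℕ} (τ : Equiv.Perm (Fin (m + 1))) (a : Fin (m + 2)) :
    Equiv.Perm (Fin (m + 2)) :=
  Equiv.ofBijective
    (Fin.snoc (α := fun _ => Fin (m + 2)) (fun i => a.succAbove (τ i)) a) <| by
    refine Finite.injective_iff_bijective.1 ?_
    rw [Fin.snoc_injective_iff]
    refine ⟨a.succAbove_right_injective.comp τ.injective, ?_⟩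
    rintro ⟨i, hi⟩
    exact Fin.succAbove_ne _ _ hi

@[simp] theorem snocPerm_castSucc {m : ℕ} (τ : Equiv.Perm (Fin (m + 1))) (a : Fin (m + 2))
    (i : Fin (m + 1)) : snocPerm τ a i.castSucc = a.succAbove (τ i) := by
  simp [snocPerm]

@[simp] theorem snocPerm_last {m : ℕ} (τ : Equiv.Perm (Fin (m + 1))) (a : Fin (m + 2)) :
    snocPerm τ a (Fin.last _) = a := by
  simp [snocPerm]

theorem isRed_snocPerm {m : ℕ} (τ : Equiv.Perm (Fin (m + 1))) (a : Fin (m + 2)) :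
    IsRed (fun i : Fin (m + 1) => snocPerm τ a i.castSucc) τ := fun i j => by
  simp

theorem eq_snocPerm {m : ℕ} {τ : Equiv.Perm (Fin (m + 1))} {π : Equiv.Perm (Fin (m + 2))}
    (h : IsRed (fun i : Fin (m + 1) => π i.castSucc) τ) :
    π = snocPerm τ (π (Fin.last _)) := by
  have hs := (h.strictMono.range_inj
    (Fin.strictMono_succAbove (π (Fin.last (m + 1))))).1 (by
      rw [τ.symm.surjective.range_comp, Fin.range_succAbove]
      ext x
      simp only [Set.mem_range, Set.mem_compl_iff, Set.mem_singleton_iff]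
      constructor
      · rintro ⟨i, rfl⟩ h
        exact (Fin.castSucc_lt_last i).ne (π.injective h)
      · intro hx
        obtain ⟨y, rfl⟩ := π.surjective x
        induction y using Fin.lastCases with
        | last => exact absurd rfl hx
        | cast i => exact ⟨i, rfl⟩)
  ext i : 1
  induction i using Fin.lastCases with
  | last => simp
  | cast i => simpa using congrFun hs (τ i)

theorem snocPerm_last_lt_iff {m : ℕ} (τ : Equiv.Perm (Fin (m + 1))) (a : Fin (m + 2))
    (i : Fin (m + 1)) :
    snocPerm τ a (Fin.last _) < snocPerm τ a i.castSucc ↔ (a : ℕ) ≤ τ i := by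
  rw [snocPerm_last, snocPerm_castSucc, Fin.lt_succAbove_iff_le_castSucc, Fin.le_def,
    Fin.val_castSucc]

/-- Two permutations with common prefix and suffix reductions have as last values the two
neighbours of the first letter of the prefix reduction. -/
theorem eq_of_isRed_snocPerm {m : ℕ} {τ ρ : Equiv.Perm (Fin (m + 1))} {a b : Fin (m + 2)}
    (ha : IsRed (fun i : Fin (m + 1) => snocPerm τ a i.succ) ρ)
    (hb : IsRed (fun i : Fin (m + 1) => snocPerm τ b i.succ) ρ) (hab : a < b) :
    a = (τ 0).castSucc ∧ b = (τ 0).succ := by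
  have key : ∀ v : ℕ, (a : ℕ) ≤ v → v < b → v = τ 0 := by
    intro v hav hvb
    obtain ⟨i, hi⟩ := τ.surjective ⟨v, by omega⟩
    have hv : (τ i : ℕ) = v := congrArg Fin.val hi
    cases m with
    | zero => rw [← hv, Fin.fin_one_eq_zero i]
    | succ m =>
      induction i using Fin.cases with
      | zero => exact hv.symm
      | succ i =>
        have h := (ha (Fin.last _) i.castSucc).trans (hb (Fin.last _) i.castSucc).symm
        simp only [Fin.succ_last, Fin.succ_castSucc, snocPerm_last_lt_iff, hv] at h
        omega
  have h1 := key a le_rfl hab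
  have h2 := key (b - 1) (by omega) (by omega)
  constructor <;> ext <;> simp <;> omega

/-- The two values adjacent to the first letter give the same suffix reduction. -/
theorem isRed_snocPerm_succ {m : ℕ} {τ ρ : Equiv.Perm (Fin (m + 1))}
    (h : IsRed (fun i : Fin (m + 1) => snocPerm τ (τ 0).castSucc i.succ) ρ) :
    IsRed (fun i : Fin (m + 1) => snocPerm τ (τ 0).succ i.succ) ρ := by
  intro i j
  rw [← h i j]
  have key (i : Fin m) : ((τ 0).succ : ℕ) ≤ τ i.succ ↔ ((τ 0).castSucc : ℕ) ≤ τ i.succ := by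
    have : (τ 0 : ℕ) ≠ τ i.succ := fun h =>
      (Fin.succ_ne_zero i) (τ.injective (Fin.ext h)).symm
    simp only [Fin.val_succ, Fin.val_castSucc]
    omega
  have gt_iff (a : Fin (m + 2)) (i : Fin m) :
      snocPerm τ a i.succ.castSucc < snocPerm τ a (Fin.last _) ↔ ¬ (a : ℕ) ≤ τ i.succ := by
    rw [← snocPerm_last_lt_iff, not_lt]
    refine ⟨le_of_lt, fun h => h.lt_of_ne fun h => ?_⟩
    exact (Fin.castSucc_lt_last _).ne ((snocPerm τ a).injective h)
  induction i using Fin.lastCases with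
  | last =>
    induction j using Fin.lastCases with
    | last => simp
    | cast j =>
      simp only [Fin.succ_last, Fin.succ_castSucc, snocPerm_last_lt_iff, key]
  | cast i =>
    induction j using Fin.lastCases with
    | last => simp only [Fin.succ_last, Fin.succ_castSucc, gt_iff, key]
    | cast j => simp [Fin.succ_castSucc, -Fin.castSucc_succ]

/-- For every `n ≥ 2` (written `n = m+2`) and every permutation `τ` of `{1,…,n-1}`:
there is exactly one permutation `ρ` of `{1,…,n-1}` such that exactly two
`n`-permutations `π` satisfy `red(π₁⋯π_{n-1}) = τ` and `red(π₂⋯π_n) = ρ`;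
moreover no `ρ` admits three or more such `π`. -/
theorem stmt1 (m : ℕ) (τ : Equiv.Perm (Fin (m + 1))) :
    (∃! ρ : Equiv.Perm (Fin (m + 1)),
      {π : Equiv.Perm (Fin (m + 2)) |
        IsRed (fun i : Fin (m + 1) => π i.castSucc) τ ∧
        IsRed (fun i : Fin (m + 1) => π i.succ) ρ}.ncard = 2) ∧
    (∀ ρ : Equiv.Perm (Fin (m + 1)),
      ¬ 3 ≤ {π : Equiv.Perm (Fin (m + 2)) |
        IsRed (fun i : Fin (m + 1) => π i.castSucc) τ ∧
        IsRed (fun i : Fin (m + 1) => π i.succ) ρ}.ncard) := by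
  set S : Equiv.Perm (Fin (m + 1)) → Set (Equiv.Perm (Fin (m + 2))) := fun ρ =>
    {π | IsRed (fun i : Fin (m + 1) => π i.castSucc) τ ∧
      IsRed (fun i : Fin (m + 1) => π i.succ) ρ}
  have pair {ρ : Equiv.Perm (Fin (m + 1))} {π σ : Equiv.Perm (Fin (m + 2))}
      (hπ : π ∈ S ρ) (hσ : σ ∈ S ρ) (hne : π ≠ σ) :
      (π = snocPerm τ (τ 0).castSucc ∧ σ = snocPerm τ (τ 0).succ) ∨
        (σ = snocPerm τ (τ 0).castSucc ∧ π = snocPerm τ (τ 0).succ) := by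
    obtain ⟨a, rfl⟩ : ∃ a, π = snocPerm τ a := ⟨_, eq_snocPerm hπ.1⟩
    obtain ⟨b, rfl⟩ : ∃ b, σ = snocPerm τ b := ⟨_, eq_snocPerm hσ.1⟩
    rcases lt_or_gt_of_ne (fun h : a = b => hne (h ▸ rfl)) with h | h
    · obtain ⟨rfl, rfl⟩ := eq_of_isRed_snocPerm hπ.2 hσ.2 h
      exact Or.inl ⟨rfl, rfl⟩
    · obtain ⟨rfl, rfl⟩ := eq_of_isRed_snocPerm hσ.2 hπ.2 h
      exact Or.inr ⟨rfl, rfl⟩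
  have no_triple (ρ : Equiv.Perm (Fin (m + 1))) : ¬ 3 ≤ (S ρ).ncard := by
    intro h
    obtain ⟨x, hx, y, hy, z, hz, hxy, hxz, hyz⟩ := (Set.two_lt_ncard (Set.toFinite _)).1 h
    rcases pair hx hy hxy with h1 | h1 <;> rcases pair hx hz hxz with h2 | h2 <;>
      rcases pair hy hz hyz with h3 | h3 <;> simp_all
  refine ⟨?_, no_triple⟩
  obtain ⟨ρ, hρ⟩ := exists_isRed
    ((snocPerm τ (τ 0).castSucc).injective.comp (Fin.succ_injective (m + 1)))
  refine ⟨ρ, ?_, fun ρ' hρ' => ?_⟩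
  · have hlt : 1 < (S ρ).ncard := (Set.one_lt_ncard (Set.toFinite _)).2
      ⟨_, ⟨isRed_snocPerm _ _, hρ⟩, _, ⟨isRed_snocPerm _ _, isRed_snocPerm_succ hρ⟩, fun h => by
        have h' := congrArg (fun π : Equiv.Perm (Fin (m + 2)) => π (Fin.last _)) h
        simp [Fin.ext_iff] at h'⟩
    have := no_triple ρ
    change (S ρ).ncard = 2
    omega
  · obtain ⟨x, hx, y, hy, hxy⟩ := (Set.one_lt_ncard (Set.toFinite _)).1
      (Nat.one_lt_two.trans_eq (show 2 = (S ρ').ncard from hρ'.symm))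
    rcases pair hx hy hxy with ⟨rfl, -⟩ | ⟨rfl, -⟩
    · exact hx.2.unique hρ
    · exact hy.2.unique hρ
end

section
/- For every integer n ≥ 2 and every permutation ρ of {1,…,n−1}, there is exactly one permutation τ of {1,…,n−1} such that exactly two permutations π of {1,…,n} satisfy red(π₁⋯π_{n−1}) = τ and red(π₂⋯π_n) = ρ. -/
theorem isRed_succAbove_iff {m : ℕ} (π : Equiv.Perm (Fin (m + 1))) (p : Fin (m + 1))
    (τ : Equiv.Perm (Fin m)) :
    IsRed (fun i => π (p.succAbove i)) τ ↔
      ∀ i, π (p.succAbove i) = (π p).succAbove (τ i) := by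
  constructor
  · intro h
    have hf : StrictMono (fun j => π (p.succAbove (τ.symm j))) := fun a b hab =>
      (h _ _).2 (by simpa using hab)
    have key := (hf.range_inj (Fin.strictMono_succAbove (π p))).1 (by
      have : (fun j => π (p.succAbove (τ.symm j))) = π ∘ p.succAbove ∘ τ.symm := rfl
      rw [this, Set.range_comp, Set.range_comp, τ.symm.surjective.range_eq, Set.image_univ,
        Fin.range_succAbove, Fin.range_succAbove, Set.image_compl_eq π.bijective,
        Set.image_singleton])
    intro i
    simpa using congrFun key (τ i)
  · intro h i j
    simp only [h, Fin.succAbove_lt_succAbove_iff]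

theorem exists_isRed_succAbove {m : ℕ} (π : Equiv.Perm (Fin (m + 1))) (p : Fin (m + 1)) :
    ∃ τ : Equiv.Perm (Fin m), IsRed (fun i => π (p.succAbove i)) τ := by
  have h : ∀ i, ∃ j, (π p).succAbove j = π (p.succAbove i) := fun i =>
    Fin.exists_succAbove_eq (by simp)
  choose f hf using h
  have hinj : Function.Injective f := fun i j hij => by
    have := (hf i).symm.trans ((congrArg _ hij).trans (hf j))
    simpa using this
  exact ⟨Equiv.ofBijective f (Finite.injective_iff_bijective.1 hinj),
    (isRed_succAbove_iff _ _ _).2 fun i => (hf i).symm⟩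

theorem exists_perm_isRed_succ {m : ℕ} (ρ : Equiv.Perm (Fin m)) (a : Fin (m + 1)) :
    ∃ π : Equiv.Perm (Fin (m + 1)), π 0 = a ∧ IsRed (fun i : Fin m => π i.succ) ρ := by
  have hinj : Function.Injective (Fin.cons a (fun i => a.succAbove (ρ i)) :
      Fin (m + 1) → Fin (m + 1)) := by
    rw [Fin.cons_injective_iff]
    refine ⟨?_, (Fin.succAbove_right_injective).comp ρ.injective⟩
    rintro ⟨i, hi⟩
    exact Fin.succAbove_ne _ _ hi
  refine ⟨Equiv.ofBijective _ (Finite.injective_iff_bijective.1 hinj), rfl, fun i j => ?_⟩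
  simp

theorem swap_castSucc_succ_lt_iff {m : ℕ} (l : Fin m) {c a b : Fin (m + 1)}
    (hc : c = l.castSucc ∨ c = l.succ) (ha : a ≠ c) (hb : b ≠ c) :
    Equiv.swap l.castSucc l.succ a < Equiv.swap l.castSucc l.succ b ↔ a < b := by
  simp only [Equiv.swap_apply_def]
  grind [Fin.val_castSucc]

/-- Two permutations with the same reduced suffix and the same reduced prefix either agree, or
start with the two values adjacent to the reduced last entry. -/
theorem apply_zero_eq_or {m : ℕ} {l t : Fin (m + 1)} {a b v w : Fin (m + 2)}
    (hv : v = a.succAbove l) (ha : a = v.succAbove t)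
    (hw : w = b.succAbove l) (hb : b = w.succAbove t) :
    a = b ∨ a = l.castSucc ∧ b = l.succ ∨ a = l.succ ∧ b = l.castSucc := by
  simp only [Fin.succAbove, Fin.lt_def] at hv ha hw hb
  simp only [Fin.ext_iff]
  split_ifs at hv ha hw hb <;> simp_all [Fin.ext_iff] <;> omega

/-- For every `n ≥ 2` (written `n = m+2`) and every permutation `ρ` of `{1,…,n-1}`,
there is exactly one permutation `τ` of `{1,…,n-1}` such that exactly two
`n`-permutations `π` satisfy `red(π₁⋯π_{n-1}) = τ` and `red(π₂⋯π_n) = ρ`. -/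
theorem stmt2 (m : ℕ) (ρ : Equiv.Perm (Fin (m + 1))) :
    ∃! τ : Equiv.Perm (Fin (m + 1)),
      {π : Equiv.Perm (Fin (m + 2)) |
        IsRed (fun i : Fin (m + 1) => π i.castSucc) τ ∧
        IsRed (fun i : Fin (m + 1) => π i.succ) ρ}.ncard = 2 := by
  have hpre (π : Equiv.Perm (Fin (m + 2))) (τ : Equiv.Perm (Fin (m + 1))) :
      IsRed (fun i : Fin (m + 1) => π i.castSucc) τ ↔
        ∀ i : Fin (m + 1), π i.castSucc = (π (Fin.last _)).succAbove (τ i) := by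
    simpa using isRed_succAbove_iff π (Fin.last _) τ
  have hsuf (π : Equiv.Perm (Fin (m + 2))) :
      IsRed (fun i : Fin (m + 1) => π i.succ) ρ ↔
        ∀ i : Fin (m + 1), π i.succ = (π 0).succAbove (ρ i) := by
    simpa using isRed_succAbove_iff π 0 ρ
  have hext {π σ : Equiv.Perm (Fin (m + 2))} (hπ : IsRed (fun i : Fin (m + 1) => π i.succ) ρ)
      (hσ : IsRed (fun i : Fin (m + 1) => σ i.succ) ρ) (h : π 0 = σ 0) : π = σ := by
    ext i
    refine Fin.cases ?_ (fun j => ?_) i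
    · rw [h]
    · rw [(hsuf π).1 hπ, (hsuf σ).1 hσ, h]
  set l := ρ (Fin.last m) with hl
  have hor {τ : Equiv.Perm (Fin (m + 1))} {π σ : Equiv.Perm (Fin (m + 2))}
      (hπ : IsRed (fun i : Fin (m + 1) => π i.castSucc) τ ∧
        IsRed (fun i : Fin (m + 1) => π i.succ) ρ)
      (hσ : IsRed (fun i : Fin (m + 1) => σ i.castSucc) τ ∧
        IsRed (fun i : Fin (m + 1) => σ i.succ) ρ) :
      π = σ ∨ π 0 = l.castSucc ∧ σ 0 = l.succ ∨ π 0 = l.succ ∧ σ 0 = l.castSucc :=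
    (apply_zero_eq_or ((hsuf π).1 hπ.2 (Fin.last m)) ((hpre π τ).1 hπ.1 0)
      ((hsuf σ).1 hσ.2 (Fin.last m)) ((hpre σ τ).1 hσ.1 0)).imp_left (hext hπ.2 hσ.2)
  obtain ⟨π, hπ0, hπ⟩ := exists_perm_isRed_succ ρ l.castSucc
  have hπl : π (Fin.last _) = l.succ := by
    have := (hsuf π).1 hπ (Fin.last m)
    rwa [hπ0, ← hl, Fin.succAbove_castSucc_self, Fin.succ_last] at this
  obtain ⟨τ, hτ⟩ := exists_isRed_succAbove π (Fin.last _)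
  simp only [Fin.succAbove_last] at hτ
  set σ : Equiv.Perm (Fin (m + 2)) := π.trans (Equiv.swap l.castSucc l.succ) with hσdef
  have hσ0 : σ 0 = l.succ := by simp [hσdef, hπ0]
  have hσ : IsRed (fun i : Fin (m + 1) => σ i.castSucc) τ ∧
      IsRed (fun i : Fin (m + 1) => σ i.succ) ρ := by
    constructor
    · intro i j
      rw [← hτ i j]
      refine swap_castSucc_succ_lt_iff l (Or.inr rfl) ?_ ?_ <;>
      · rw [← hπl, π.injective.ne_iff]
        exact Fin.castSucc_ne_last _
    · intro i j
      rw [← hπ i j]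
      refine swap_castSucc_succ_lt_iff l (Or.inl rfl) ?_ ?_ <;>
      · rw [← hπ0, π.injective.ne_iff]
        exact Fin.succ_ne_zero _
  have hne : π ≠ σ := fun h => by
    have := congrArg (fun f : Equiv.Perm (Fin (m + 2)) => f 0) h
    simp only [hπ0, hσ0] at this
    exact Fin.castSucc_lt_succ.ne this
  refine ⟨τ, ?_, fun τ' hτ' => ?_⟩
  · refine Set.ncard_eq_two.2 ⟨π, σ, hne, Set.Subset.antisymm (fun x hx => ?_) ?_⟩
    · rcases hor ⟨hτ, hπ⟩ hx with h | h | h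
      · exact Or.inl h.symm
      · exact Or.inr (hext hx.2 hσ.2 (h.2.trans hσ0.symm))
      · exact Or.inl (hext hx.2 hπ (h.2.trans hπ0.symm))
    · rintro x (rfl | rfl)
      exacts [⟨hτ, hπ⟩, hσ]
  · obtain ⟨x, y, hxy, hS⟩ := Set.ncard_eq_two.1 hτ'
    have hx := hS.ge (Set.mem_insert x {y})
    have hy := hS.ge (Set.mem_insert_of_mem x (Set.mem_singleton y))
    have hπτ' : IsRed (fun i : Fin (m + 1) => π i.castSucc) τ' := by
      rcases hor hx hy with h | h | h
      · exact absurd h hxy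
      · rw [hext hπ hx.2 (hπ0.trans h.1.symm)]
        exact hx.1
      · rw [hext hπ hy.2 (hπ0.trans h.2.symm)]
        exact hy.1
    refine Equiv.ext fun i => Fin.succAbove_right_injective (p := π (Fin.last _)) ?_
    rw [← (hpre π τ').1 hπτ', ← (hpre π τ).1 hτ]
end

section
/- For every integer n ≥ 2 and every integer k with 0 ≤ k ≤ (n−2)!, there exists a word w = w₁⋯w_L over the positive integers of length L = n! + (1−k)(n−1) such that: (i) any two equal letters of w occur at positions whose difference is at least n−1; and (ii) every permutation π of {1,…,n} is a linear extension of exactly one length-n factor of w, i.e., there is exactly one index i ∈ {1,…,L−n+1} such that for all 1 ≤ j, l ≤ n, w_{i+j−1} < w_{i+l−1} implies π(j) < π(l). -/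
theorem sameCycle_mul_swap {E : Type*} [Finite E] [DecidableEq E] (f : Equiv.Perm E) {x y : E}
    (hxy : ¬ f.SameCycle x y) :
    (f * Equiv.swap x y).SameCycle x y ∧
      ∀ z, f.SameCycle x z → (f * Equiv.swap x y).SameCycle x z := by
  set g := f * Equiv.swap x y with hg
  have hgx : g x = f y := by simp [hg]
  have hgy : g y = f x := by simp [hg]
  have hgz : ∀ z, z ≠ x → z ≠ y → g z = f z := fun z h1 h2 => by
    simp [hg, Equiv.swap_apply_of_ne_of_ne h1 h2]
  have hy : g.SameCycle x y := by
    by_contra hy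
    have key : ∀ i : ℕ, g.SameCycle x ((f ^ (i + 1)) y) := by
      intro i
      induction i with
      | zero => simpa [← hgx] using Equiv.Perm.SameCycle.refl g x
      | succ i ih =>
        have h1 : (f ^ (i + 1)) y ≠ x := fun h => hxy (by
          rw [← h]; exact (Equiv.Perm.sameCycle_pow_left).2 (Equiv.Perm.SameCycle.refl f y))
        have h2 : (f ^ (i + 1)) y ≠ y := fun h => hy (by rwa [h] at ih)
        rw [pow_succ', Equiv.Perm.mul_apply, ← hgz _ h1 h2]
        exact Equiv.Perm.sameCycle_apply_right.2 ih
    have h := key (orderOf f - 1)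
    rw [Nat.sub_add_cancel (orderOf_pos f), pow_orderOf_eq_one] at h
    exact hy h
  refine ⟨hy, fun z hz => ?_⟩
  obtain ⟨i, rfl⟩ := hz.exists_nat_pow_eq
  clear hz
  induction i with
  | zero => exact Equiv.Perm.SameCycle.refl g x
  | succ i ih =>
    rw [pow_succ', Equiv.Perm.mul_apply]
    by_cases h1 : (f ^ i) x = x
    · rw [h1, ← hgy]; exact Equiv.Perm.sameCycle_apply_right.2 hy
    · have h2 : (f ^ i) x ≠ y := fun h => hxy ⟨i, by simpa using h⟩
      rw [← hgz _ h1 h2]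
      exact Equiv.Perm.sameCycle_apply_right.2 ih

/-- A finite connected balanced directed multigraph with edge set `E` has an Eulerian circuit. -/
theorem exists_eulerian_circuit {E V : Type*} [Fintype E] [Nonempty E] (s t : E → V)
    (hbal : ∀ v, Nat.card {e // t e = v} = Nat.card {e // s e = v})
    (hconn : ∀ S : Set E, S.Nonempty → (∀ a ∈ S, ∀ b, s b = t a → b ∈ S) → S = Set.univ) :
    ∃ x : ℕ → E, (∀ i, s (x (i + 1)) = t (x i)) ∧
      ∀ e, ∃! i, i < Fintype.card E ∧ x i = e := by
  classical
  obtain ⟨e₀⟩ := ‹Nonempty E›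
  have hne : ∃ f : Equiv.Perm E, ∀ e, s (f e) = t e := by
    have h : ∀ v, Nonempty ({e // t e = v} ≃ {e // s e = v}) := fun v => Finite.card_eq.1 (hbal v)
    let F := fun v => (h v).some
    refine ⟨(Equiv.sigmaFiberEquiv t).symm.trans
      ((Equiv.sigmaCongrRight F).trans (Equiv.sigmaFiberEquiv s)), fun e => ?_⟩
    exact (F (t e) ⟨e, rfl⟩).2
  obtain ⟨f, hf, hmax⟩ := Set.exists_max_image {f : Equiv.Perm E | ∀ e, s (f e) = t e}
    (fun f => Set.ncard {z | f.SameCycle e₀ z}) (Set.toFinite _) hne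
  have hall : {z | f.SameCycle e₀ z} = Set.univ := by
    refine hconn _ ⟨e₀, Equiv.Perm.SameCycle.refl f e₀⟩ fun a ha b hab => ?_
    by_contra hb
    have hab' : ¬ f.SameCycle a (f⁻¹ b) := fun h =>
      hb (ha.trans (Equiv.Perm.sameCycle_symm_apply_right.1 h))
    obtain ⟨h1, h2⟩ := sameCycle_mul_swap f hab'
    set g := f * Equiv.swap a (f⁻¹ b) with hg
    have htb : t (f⁻¹ b) = t a := by rw [← hf (f⁻¹ b)]; simpa using hab
    have hgs : ∀ e, s (g e) = t e := by
      intro e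
      rw [hg, Equiv.Perm.mul_apply, hf]
      by_cases h3 : e = a
      · subst h3; simpa using htb
      · by_cases h4 : e = f⁻¹ b
        · subst h4; simpa using htb.symm
        · rw [Equiv.swap_apply_of_ne_of_ne h3 h4]
    have hga : g.SameCycle e₀ a := (h2 e₀ (Equiv.Perm.SameCycle.symm ha)).symm
    have hlt : {z | f.SameCycle e₀ z} ⊂ {z | g.SameCycle e₀ z} := by
      refine (Set.ssubset_iff_of_subset fun z hz => ?_).2 ⟨f⁻¹ b, hga.trans h1, fun h => ?_⟩
      · exact hga.trans (h2 z (Equiv.Perm.SameCycle.trans (Equiv.Perm.SameCycle.symm ha) hz))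
      · exact hb (Equiv.Perm.sameCycle_symm_apply_right.1 h)
    exact absurd (hmax g hgs) (not_le.2 (Set.ncard_lt_ncard hlt (Set.toFinite _)))
  refine ⟨fun i => (f ^ i) e₀, fun i => ?_, ?_⟩
  · simp only [pow_succ', Equiv.Perm.mul_apply]; exact hf _
  · have hsurj : Function.Surjective (fun i : Fin (Fintype.card E) => (f ^ (i : ℕ)) e₀) := by
      intro e
      have he : f.SameCycle e₀ e := (Set.eq_univ_iff_forall.1 hall) e
      have hpos := Function.minimalPeriod_pos_of_mem_periodicPts
        (f.injective.mem_periodicPts e₀)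
      obtain ⟨i, hi⟩ := he.exists_nat_pow_eq
      refine ⟨⟨i % Function.minimalPeriod f e₀, (Nat.mod_lt _ hpos).trans_le
        Function.minimalPeriod_le_card⟩, ?_⟩
      rw [← hi]
      simp only [Equiv.Perm.coe_pow]
      exact Function.iterate_mod_minimalPeriod_eq
    have hbij := (Fintype.bijective_iff_surjective_and_card _).2 ⟨hsurj, by simp⟩
    intro e
    obtain ⟨i, hi⟩ := hsurj e
    exact ⟨i, ⟨i.2, hi⟩, fun j hj =>
      congrArg Fin.val (hbij.1 (a₁ := ⟨j, hj.1⟩) (a₂ := i) (hj.2.trans hi.symm))⟩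

theorem exists_invariant_finset {α : Type*} [Fintype α] [DecidableEq α] (f : Equiv.Perm α)
    {m : ℕ} (hm : 0 < m) (hf : f ^ m = 1)
    (hfree : ∀ x i, 0 < i → i < m → (f ^ i) x ≠ x) (k : ℕ) (hk : k * m ≤ Fintype.card α) :
    ∃ C : Finset α, C.card = k * m ∧ ∀ x, f x ∈ C ↔ x ∈ C := by
  induction k with
  | zero => exact ⟨∅, by simp, by simp⟩
  | succ k ih =>
    rw [Nat.succ_mul] at hk
    obtain ⟨C, hC, hinv⟩ := ih (by omega)
    obtain ⟨x, hx⟩ : ∃ x, x ∉ C := by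
      by_contra! h
      rw [Finset.eq_univ_of_forall h, Finset.card_univ] at hC
      omega
    have hpow : ∀ i y, (f ^ i) y ∈ C ↔ y ∈ C := by
      intro i y
      induction i with
      | zero => simp
      | succ i ih => rw [pow_succ', Equiv.Perm.mul_apply, hinv, ih]
    have hinj : Set.InjOn (fun i => (f ^ i) x) (Finset.range m : Finset ℕ) := by
      have aux : ∀ i j, i < j → j < m → (f ^ i) x ≠ (f ^ j) x := fun i j hij hj h => by
        refine hfree ((f ^ i) x) (j - i) (by omega) (by omega) ?_
        rw [← Equiv.Perm.mul_apply, ← pow_add, Nat.sub_add_cancel hij.le, h]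
      intro i hi j hj h
      simp only [Finset.coe_range, Set.mem_Iio] at hi hj
      rcases lt_trichotomy i j with h1 | h1 | h1
      · exact absurd h (aux i j h1 hj)
      · exact h1
      · exact absurd h.symm (aux j i h1 hi)
    have hdisj : Disjoint C ((Finset.range m).image fun i => (f ^ i) x) := by
      rw [Finset.disjoint_right]
      intro y hy
      obtain ⟨i, -, rfl⟩ := Finset.mem_image.1 hy
      rwa [hpow]
    have horb : ∀ y ∈ (Finset.range m).image (fun i => (f ^ i) x),
        ∀ j, (f ^ j) y ∈ (Finset.range m).image (fun i => (f ^ i) x) := by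
      intro y hy j
      obtain ⟨i, -, rfl⟩ := Finset.mem_image.1 hy
      refine Finset.mem_image.2 ⟨(j + i) % m, Finset.mem_range.2 (Nat.mod_lt _ hm), ?_⟩
      rw [← Equiv.Perm.mul_apply, ← pow_add, ← pow_eq_pow_mod _ hf]
    refine ⟨C ∪ (Finset.range m).image fun i => (f ^ i) x, ?_, fun y => ?_⟩
    · rw [Finset.card_union_of_disjoint hdisj, hC, Finset.card_image_of_injOn hinj,
        Finset.card_range, Nat.succ_mul]
    · rw [Finset.mem_union, Finset.mem_union, hinv]
      refine or_congr Iff.rfl ⟨fun h => ?_, fun h => by simpa using horb y h 1⟩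
      have := horb _ h (m - 1)
      rwa [← Equiv.Perm.mul_apply, ← pow_succ, Nat.sub_add_cancel hm, hf] at this


theorem perm_eq_of_lt_imp {n : ℕ} {e π : Equiv.Perm (Fin n)}
    (h : ∀ i j, e i < e j → π i < π j) : π = e := by
  have hm : StrictMono (π ∘ e.symm) := fun a b hab => h _ _ (by simpa using hab)
  have h1 : (e.symm.trans π : Equiv.Perm (Fin n)) = Equiv.refl _ := by
    have := Subsingleton.elim (hm.orderIsoOfSurjective _ (π.surjective.comp e.symm.surjective))
      (OrderIso.refl (Fin n))
    ext x
    exact congrArg Fin.val (DFunLike.congr_fun this x)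
  ext x
  simpa using congrArg Fin.val (DFunLike.congr_fun h1 (e x))

theorem exists_perm_lt_iff_lt {n : ℕ} {α : Type*} [LinearOrder α] (y : Fin n → α)
    (hy : Function.Injective y) : ∃ π : Equiv.Perm (Fin n), ∀ i j, π i < π j ↔ y i < y j := by
  have hm : StrictMono (y ∘ Tuple.sort y) :=
    (Tuple.monotone_sort y).strictMono_of_injective (hy.comp (Tuple.sort y).injective)
  refine ⟨(Tuple.sort y).symm, fun i j => ?_⟩
  rw [← hm.lt_iff_lt]
  simp

theorem val_finRotate_pow_apply (q i : ℕ) (x : Fin (q + 1)) :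
    ((((finRotate (q + 1)) ^ i) x : Fin (q + 1)) : ℕ) = (x + i) % (q + 1) := by
  induction i with
  | zero => simp [Nat.mod_eq_of_lt x.2]
  | succ i ih =>
    rw [pow_succ', Equiv.Perm.mul_apply, finRotate_apply, Fin.val_add, ih, Fin.val_one',
      ← Nat.add_mod, add_assoc]

/-- The order pattern of all entries but the last. -/
def srcPattern {q : ℕ} (π : Equiv.Perm (Fin (q + 2))) : Fin (q + 1) → Fin (q + 1) → Prop :=
  fun i j => π i.castSucc < π j.castSucc

/-- The order pattern of all entries but the first. -/
def tgtPattern {q : ℕ} (π : Equiv.Perm (Fin (q + 2))) : Fin (q + 1) → Fin (q + 1) → Prop :=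
  fun i j => π i.succ < π j.succ

/-- Comparing an interior entry with the last entry or with the first one gives the same result. -/
def EndsAdjacent {q : ℕ} (π : Equiv.Perm (Fin (q + 2))) : Prop :=
  ∀ a : Fin (q + 1), a ≠ 0 →
    (π a.castSucc < π (Fin.last _) ↔ π a.castSucc < π 0) ∧
    (π (Fin.last _) < π a.castSucc ↔ π 0 < π a.castSucc)

theorem EndsAdjacent.lt_iff_lt {q : ℕ} {π π' : Equiv.Perm (Fin (q + 2))} (h : EndsAdjacent π)
    (h' : EndsAdjacent π') (hs : srcPattern π = srcPattern π') (j l : Fin (q + 2))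
    (hjl : ¬ (j = 0 ∧ l = Fin.last _ ∨ j = Fin.last _ ∧ l = 0)) : π j < π l ↔ π' j < π' l := by
  have hs' : ∀ a b : Fin (q + 1), π a.castSucc < π b.castSucc ↔ π' a.castSucc < π' b.castSucc :=
    fun a b => iff_of_eq (congrFun (congrFun hs a) b)
  induction j using Fin.lastCases with
  | last =>
    induction l using Fin.lastCases with
    | last => simp
    | cast b =>
      have hb : b ≠ 0 := by rintro rfl; exact hjl (Or.inr ⟨rfl, rfl⟩)
      rw [(h b hb).2, (h' b hb).2]
      exact hs' 0 b
  | cast a =>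
    induction l using Fin.lastCases with
    | last =>
      have ha : a ≠ 0 := by rintro rfl; exact hjl (Or.inl ⟨rfl, rfl⟩)
      rw [(h a ha).1, (h' a ha).1]
      exact hs' a 0
    | cast b => exact hs' a b

/-- Append to `σ` a new last entry just above (`d = 1`) or just below (`d = -1`) its first one. -/
theorem exists_twin (q : ℕ) (σ : Equiv.Perm (Fin (q + 1))) (d : ℤ) (hd : d = 1 ∨ d = -1) :
    ∃ π : Equiv.Perm (Fin (q + 2)),
      srcPattern π = (fun i j => σ i < σ j) ∧
      tgtPattern π = (fun i j => σ (finRotate _ i) < σ (finRotate _ j)) ∧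
      EndsAdjacent π ∧
      (π 0 < π (Fin.last _) ↔ d = 1) := by
  let y : Fin (q + 2) → ℤ :=
    Fin.snoc (α := fun _ => ℤ) (fun i => 2 * ((σ i : ℕ) : ℤ)) (2 * ((σ 0 : ℕ) : ℤ) + d)
  have hc : ∀ i : Fin (q + 1), y i.castSucc = 2 * ((σ i : ℕ) : ℤ) := fun i => by simp [y]
  have hl : y (Fin.last _) = 2 * ((σ 0 : ℕ) : ℤ) + d := by simp [y]
  have h0 : y 0 = 2 * ((σ 0 : ℕ) : ℤ) := hc 0
  have hinj : Function.Injective y := by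
    intro a b hab
    induction a using Fin.lastCases with
    | last =>
      induction b using Fin.lastCases with
      | last => rfl
      | cast b => rw [hl, hc] at hab; omega
    | cast a =>
      induction b using Fin.lastCases with
      | last => rw [hl, hc] at hab; omega
      | cast b =>
        rw [hc, hc] at hab
        have : σ a = σ b := Fin.ext (by omega)
        rw [σ.injective this]
  have hne : ∀ i : Fin (q + 1), i ≠ 0 → (σ i : ℕ) ≠ σ 0 := fun i hi h =>
    hi (σ.injective (Fin.ext h))
  obtain ⟨π, hπ⟩ := exists_perm_lt_iff_lt y hinj
  have hcc : ∀ i j : Fin (q + 1), π i.castSucc < π j.castSucc ↔ σ i < σ j := fun i j => by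
    rw [hπ, hc, hc, Fin.lt_def]; omega
  have hcl : ∀ i : Fin (q + 1), i ≠ 0 → (π i.castSucc < π (Fin.last _) ↔ σ i < σ 0) :=
    fun i hi => by
      have := hne i hi
      rw [hπ, hc, hl, Fin.lt_def]; omega
  have hlc : ∀ i : Fin (q + 1), i ≠ 0 → (π (Fin.last _) < π i.castSucc ↔ σ 0 < σ i) :=
    fun i hi => by
      have := hne i hi
      rw [hπ, hc, hl, Fin.lt_def]; omega
  have hrot : ∀ a : Fin q, finRotate (q + 1) a.castSucc = a.succ := fun a =>
    finRotate_of_lt a.2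
  refine ⟨π, ?_, ?_, fun a ha => ⟨?_, ?_⟩, ?_⟩
  · funext i j
    exact propext (hcc i j)
  · funext i j
    refine propext ?_
    unfold tgtPattern
    induction i using Fin.lastCases with
    | last =>
      induction j using Fin.lastCases with
      | last => simp
      | cast b =>
        rw [finRotate_last, hrot, ← hlc _ b.succ_ne_zero, Fin.succ_last, Fin.succ_castSucc]
    | cast a =>
      induction j using Fin.lastCases with
      | last =>
        rw [finRotate_last, hrot, ← hcl _ a.succ_ne_zero, Fin.succ_last, Fin.succ_castSucc]
      | cast b => rw [hrot, hrot, ← hcc, Fin.succ_castSucc, Fin.succ_castSucc]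
  · rw [hcl a ha]; exact (hcc a 0).symm
  · rw [hlc a ha]; exact (hcc 0 a).symm
  · rw [hπ, h0, hl]; omega

theorem exists_rat_between {q : ℕ} (e : Equiv.Perm (Fin (q + 2))) (y : Fin (q + 1) → ℚ)
    (hy : ∀ a b, y a < y b ↔ e a.castSucc < e b.castSucc) :
    ∃ z : ℚ, ∀ a : Fin (q + 1), (y a < z ↔ e a.castSucc < e (Fin.last _)) ∧
      (z < y a ↔ e (Fin.last _) < e a.castSucc) := by
  obtain ⟨z, h1, h2⟩ := Order.exists_between_finsets
    ((Finset.univ.filter fun a : Fin (q + 1) => e a.castSucc < e (Fin.last _)).image y)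
    ((Finset.univ.filter fun a : Fin (q + 1) => e (Fin.last _) < e a.castSucc).image y)
    (by
      intro u hu v hv
      simp only [Finset.mem_image, Finset.mem_filter, Finset.mem_univ, true_and] at hu hv
      obtain ⟨a, ha, rfl⟩ := hu
      obtain ⟨b, hb, rfl⟩ := hv
      exact (hy a b).2 (ha.trans hb))
  have h1' : ∀ a : Fin (q + 1), e a.castSucc < e (Fin.last _) → y a < z := fun a ha =>
    h1 _ (Finset.mem_image_of_mem _ (by simpa using ha))
  have h2' : ∀ a : Fin (q + 1), e (Fin.last _) < e a.castSucc → z < y a := fun a ha =>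
    h2 _ (Finset.mem_image_of_mem _ (by simpa using ha))
  refine ⟨z, fun a => ?_⟩
  have hne : e a.castSucc ≠ e (Fin.last _) := fun h => a.castSucc_ne_last (e.injective h)
  rcases lt_or_gt_of_ne hne with h | h
  · have := h1' a h
    exact ⟨iff_of_true this h, iff_of_false this.not_gt h.not_gt⟩
  · have := h2' a h
    exact ⟨iff_of_false this.not_gt h.not_gt, iff_of_true this h⟩

theorem exists_next_window {q : ℕ} (e e' : Equiv.Perm (Fin (q + 2))) (c : Prop)
    (he : srcPattern e' = tgtPattern e)
    (hc : c → EndsAdjacent e)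
    (y : Fin (q + 1) → ℚ) (hy : ∀ a b, y a < y b ↔ srcPattern e a b) :
    ∃ y' : Fin (q + 1) → ℚ, (∀ a b, y' a < y' b ↔ srcPattern e' a b) ∧
      (∀ a : Fin q, y' a.castSucc = y a.succ) ∧
      (∀ a : Fin (q + 1), ¬ (c ∧ a = 0) →
        (y a < y' (Fin.last _) ↔ e a.castSucc < e (Fin.last _)) ∧
        (y' (Fin.last _) < y a ↔ e (Fin.last _) < e a.castSucc)) ∧
      (c → y' (Fin.last _) = y 0) := by
  obtain ⟨z, hz, hcz⟩ : ∃ z : ℚ, (∀ a : Fin (q + 1), ¬ (c ∧ a = 0) →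
        (y a < z ↔ e a.castSucc < e (Fin.last _)) ∧
        (z < y a ↔ e (Fin.last _) < e a.castSucc)) ∧ (c → z = y 0) := by
    by_cases h : c
    · refine ⟨y 0, fun a ha => ?_, fun _ => rfl⟩
      have := hc h a (fun h0 => ha ⟨h, h0⟩)
      rw [this.1, this.2, hy, hy]
      exact ⟨Iff.rfl, Iff.rfl⟩
    · obtain ⟨z, hz⟩ := exists_rat_between e y hy
      exact ⟨z, fun a _ => hz a, fun h' => absurd h' h⟩
  refine ⟨Fin.snoc (α := fun _ => ℚ) (fun a : Fin q => y a.succ) z, ?_, by simp, by simpa using hz,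
    by simpa using hcz⟩
  intro a b
  rw [he]
  unfold tgtPattern
  induction a using Fin.lastCases with
  | last =>
    induction b using Fin.lastCases with
    | last => simp
    | cast b => simpa using (hz b.succ (by simp)).2
  | cast a =>
    induction b using Fin.lastCases with
    | last => simpa using (hz a.succ (by simp)).1
    | cast b => simpa [srcPattern] using hy a.succ b.succ

theorem exists_rat_word {q : ℕ} (e : ℕ → Equiv.Perm (Fin (q + 2))) (c : ℕ → Prop)
    (he : ∀ i, srcPattern (e (i + 1)) = tgtPattern (e i))
    (hc : ∀ i, c i → EndsAdjacent (e i)) :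
    ∃ x : ℕ → ℚ, ∀ i, (c i → x (i + (q + 1)) = x i) ∧
      ∀ j l : Fin (q + 2), ¬ (c i ∧ (j = 0 ∧ l = Fin.last _ ∨ j = Fin.last _ ∧ l = 0)) →
        (x (i + j) < x (i + l) ↔ e i j < e i l) := by
  choose nxt h1 h2 h3 h4 using fun i => exists_next_window (e i) (e (i + 1)) (c i) (he i) (hc i)
  let Y : ∀ i, {y : Fin (q + 1) → ℚ // ∀ a b, y a < y b ↔ srcPattern (e i) a b} := fun i =>
    Nat.rec ⟨fun a => ((e 0 a.castSucc : ℕ) : ℚ), fun a b => by simp [srcPattern]⟩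
      (fun i y => ⟨nxt i y.1 y.2, h1 i y.1 y.2⟩) i
  have hY : ∀ i, (Y (i + 1)).1 = nxt i (Y i).1 (Y i).2 := fun i => rfl
  let x : ℕ → ℚ := fun i => (Y i).1 0
  have hx : ∀ (a : ℕ) (ha : a < q + 1) i, x (i + a) = (Y i).1 ⟨a, ha⟩ := by
    intro a
    induction a with
    | zero => intro ha i; rfl
    | succ a ih =>
      intro ha i
      rw [show i + (a + 1) = i + 1 + a by ring, ih (by omega), hY]
      exact h2 i (Y i).1 (Y i).2 ⟨a, by omega⟩
  have hl : ∀ i, x (i + (q + 1)) = nxt i (Y i).1 (Y i).2 (Fin.last _) := fun i => by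
    rw [show i + (q + 1) = i + 1 + q by ring, hx q (by omega), hY]; rfl
  refine ⟨x, fun i => ⟨fun h => ?_, fun j l hjl => ?_⟩⟩
  · rw [hl]; exact h4 i _ _ h
  · induction j using Fin.lastCases with
    | last =>
      induction l using Fin.lastCases with
      | last => simp
      | cast b =>
        rw [Fin.val_castSucc, Fin.val_last, hx b b.2, hl]
        refine (h3 i _ _ b ?_).2
        rintro ⟨h, rfl⟩
        exact hjl ⟨h, Or.inr ⟨rfl, rfl⟩⟩
    | cast a =>
      induction l using Fin.lastCases with
      | last =>
        rw [Fin.val_castSucc, Fin.val_last, hx a a.2, hl]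
        refine (h3 i _ _ a ?_).1
        rintro ⟨h, rfl⟩
        exact hjl ⟨h, Or.inl ⟨rfl, rfl⟩⟩
      | cast b =>
        rw [Fin.val_castSucc, Fin.val_castSucc, hx a a.2, hx b b.2]
        exact (Y i).2 a b

theorem exists_pos_nat_word (x : ℕ → ℚ) (L : ℕ) :
    ∃ w : ℕ → ℕ, (∀ i, 0 < w i) ∧ ∀ i j, i < L → j < L → (w i < w j ↔ x i < x j) := by
  refine ⟨fun i => ((Finset.range L).filter fun l => x l < x i).card + 1, fun i => Nat.succ_pos _,
    fun i j hi hj => ?_⟩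
  have mono : ∀ {i j}, x i ≤ x j → ((Finset.range L).filter fun l => x l < x i).card ≤
      ((Finset.range L).filter fun l => x l < x j).card := fun {i j} h =>
    Finset.card_le_card fun l hl => by
      simp only [Finset.mem_filter] at hl ⊢
      exact ⟨hl.1, hl.2.trans_le h⟩
  constructor
  · intro h
    by_contra! h'
    have := mono h'
    simp only at h
    omega
  · intro h
    have : ((Finset.range L).filter fun l => x l < x i) ⊂
        ((Finset.range L).filter fun l => x l < x j) := by
      refine (Finset.ssubset_iff_of_subset fun l hl => ?_).2 ⟨i, by simp [hi, h], by simp⟩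
      simp only [Finset.mem_filter] at hl ⊢
      exact ⟨hl.1, hl.2.trans h⟩
    exact Nat.succ_lt_succ (Finset.card_lt_card this)

theorem card_fiber_compl_eq {α V : Type*} [Fintype α] [DecidableEq α] (R : Finset α)
    (s t : α → V) (hα : ∃ f : Equiv.Perm α, ∀ a, s (f a) = t a)
    (hR : ∃ g : Equiv.Perm α, (∀ a, g a ∈ R ↔ a ∈ R) ∧ ∀ a ∈ R, s (g a) = t a) (v : V) :
    Nat.card {e : {a // a ∉ R} // t e = v} = Nat.card {e : {a // a ∉ R} // s e = v} := by
  classical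
  obtain ⟨f, hf⟩ := hα
  obtain ⟨g, hgR, hg⟩ := hR
  have key : ∀ p : α → Prop, Nat.card {e : {a // a ∉ R} // p e} + (R.filter p).card =
      (Finset.univ.filter p).card := fun p => by
    rw [Nat.card_congr (Equiv.subtypeSubtypeEquivSubtypeInter (fun a => a ∉ R) p),
      Nat.card_eq_fintype_card, Fintype.card_subtype, ← Finset.card_union_of_disjoint]
    · congr 1
      ext a
      simp only [Finset.mem_union, Finset.mem_filter, Finset.mem_univ, true_and]
      tauto
    · rw [Finset.disjoint_left]
      intro a ha ha'
      exact (Finset.mem_filter.1 ha).2.1 (Finset.mem_filter.1 ha').1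
  have h1 : (Finset.univ.filter fun a => t a = v).card =
      (Finset.univ.filter fun a => s a = v).card :=
    Finset.card_equiv f fun a => by simp [hf]
  have h2 : (R.filter fun a => t a = v).card = (R.filter fun a => s a = v).card :=
    Finset.card_equiv g fun a => by
      simp only [Finset.mem_filter, hgR]
      exact and_congr_right fun ha => by rw [hg a ha]
  have h3 := key fun a => t a = v
  have h4 := key fun a => s a = v
  omega

theorem srcPattern_mul_finRotate {q : ℕ} (π : Equiv.Perm (Fin (q + 2))) :
    srcPattern (π * finRotate (q + 2)) = tgtPattern π := by
  have h : ∀ a : Fin (q + 1), finRotate (q + 2) a.castSucc = a.succ := fun a =>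
    finRotate_of_lt a.2
  funext i j
  simp only [srcPattern, tgtPattern, Equiv.Perm.mul_apply, h]

theorem patterns_connected {q : ℕ} (P : Equiv.Perm (Fin (q + 2)) → Prop)
    (hP : ∀ π, ∃ e, P e ∧ srcPattern e = srcPattern π ∧ tgtPattern e = tgtPattern π)
    (S : Set {π // P π}) (hne : S.Nonempty)
    (hS : ∀ a ∈ S, ∀ b : {π // P π}, srcPattern b.1 = tgtPattern a.1 → b ∈ S) :
    S = Set.univ := by
  obtain ⟨a, ha⟩ := hne
  refine Set.eq_univ_of_forall fun b => ?_
  let x : ℕ → ℕ := fun i => if h : i < q + 2 then a.1 ⟨i, h⟩ else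
    if h : i - (q + 2) < q + 2 then q + 2 + b.1 ⟨i - (q + 2), h⟩ else i
  have hx : Function.Injective x := by
    intro i j hij
    simp only [x] at hij
    split_ifs at hij with h1 h2 h3 h4 h5 h6 h7
    · simpa using a.1.injective (Fin.ext hij)
    all_goals first
      | omega
      | (have h := b.1.injective (Fin.ext (Nat.add_left_cancel hij))
         simp only [Fin.mk.injEq] at h
         omega)
  have hwin : ∀ i, ∃ π : Equiv.Perm (Fin (q + 2)), ∀ j l, π j < π l ↔ x (i + j) < x (i + l) :=
    fun i => exists_perm_lt_iff_lt (fun j => x (i + j))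
      (hx.comp fun j l h => Fin.ext (Nat.add_left_cancel h))
  have key : ∀ i, ∀ e : {π // P π},
      (srcPattern e.1 = fun c d : Fin (q + 1) => x (i + 1 + c) < x (i + 1 + d)) → e ∈ S := by
    intro i
    induction i with
    | zero =>
      intro e he
      refine hS a ha e (he.trans ?_)
      funext c d
      have hc : ∀ c : Fin (q + 1), x (0 + 1 + c) = a.1 c.succ := fun c => by
        have : 0 + 1 + (c : ℕ) < q + 2 := by omega
        simp only [x, this, dif_pos]
        congr 2
        exact Fin.ext (by simp [add_comm])
      rw [hc, hc]
      rfl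
    | succ i ih =>
      intro e he
      obtain ⟨π, hπ⟩ := hwin (i + 1)
      obtain ⟨e', he', hs, ht⟩ := hP π
      refine hS ⟨e', he'⟩ (ih _ (hs.trans ?_)) e (he.trans (Eq.trans ?_ ht.symm))
      · funext c d
        exact propext (hπ c.castSucc d.castSucc)
      · funext c d
        simp only [tgtPattern, hπ, Fin.val_succ, add_assoc, add_comm 1]
  refine key (q + 1) b ?_
  funext c d
  have hc : ∀ c : Fin (q + 1), x (q + 1 + 1 + c) = q + 2 + b.1 c.castSucc := fun c => by
    have h1 : ¬ (q + 1 + 1 + (c : ℕ) < q + 2) := by omega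
    have h2 : q + 1 + 1 + (c : ℕ) - (q + 2) = c := by omega
    have h3 : (c : ℕ) < q + 2 := by omega
    simp only [x, h1, h2, h3, dif_pos, dif_neg, not_false_eq_true]
    rfl
  rw [hc, hc]
  simp [srcPattern]

theorem exists_invariant_perm_finset (q k : ℕ) (hk : k ≤ q.factorial) :
    ∃ C : Finset (Equiv.Perm (Fin (q + 1))), C.card = k * (q + 1) ∧
      ∀ σ, σ * finRotate (q + 1) ∈ C ↔ σ ∈ C := by
  have hpow : ∀ i σ, ((Equiv.mulRight (finRotate (q + 1))) ^ i) σ = σ * finRotate (q + 1) ^ i := by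
    intro i σ
    induction i with
    | zero => simp
    | succ i ih => rw [pow_succ', Equiv.Perm.mul_apply, ih, pow_succ, ← mul_assoc]; rfl
  refine exists_invariant_finset (Equiv.mulRight (finRotate (q + 1))) q.succ_pos ?_ ?_ k ?_
  · ext1 σ
    rw [hpow]
    rw [show finRotate (q + 1) ^ (q + 1) = 1 from Equiv.ext fun x => Fin.ext (by
      simp [val_finRotate_pow_apply, Nat.mod_eq_of_lt x.2])]
    simp
  · intro σ i hi hiq h
    rw [hpow, mul_eq_left] at h
    have h' := val_finRotate_pow_apply q i 0
    rw [h] at h'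
    simp only [Equiv.Perm.one_apply, Fin.val_zero, zero_add, Nat.mod_eq_of_lt hiq] at h'
    omega
  · rw [Fintype.card_perm, Fintype.card_fin, Nat.factorial_succ, mul_comm]
    exact Nat.mul_le_mul_left _ hk


/-- For every `n ≥ 2` and every `k` with `0 ≤ k ≤ (n-2)!`, there is a word `w`
over the positive integers of length `L = n! + (1-k)(n-1) = n! + (n-1) - k(n-1)`
such that equal letters occur at distance at least `n-1` from each other, and every
permutation `π` of `{1,…,n}` is a linear extension of exactly one length-`n`
factor of `w`. -/
theorem stmt4 (n k : ℕ) (hn : 2 ≤ n) (hk : k ≤ Nat.factorial (n - 2)) :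
    ∃ w : ℕ → ℕ,
      (∀ i, i < Nat.factorial n + (n - 1) - k * (n - 1) → 0 < w i) ∧
      (∀ i j, i < j → j < Nat.factorial n + (n - 1) - k * (n - 1) →
        w i = w j → n - 1 ≤ j - i) ∧
      (∀ π : Equiv.Perm (Fin n),
        ∃! i : ℕ, i + n ≤ Nat.factorial n + (n - 1) - k * (n - 1) ∧
          ∀ j l : Fin n, w (i + (j : ℕ)) < w (i + (l : ℕ)) → π j < π l) := by
  obtain ⟨q, rfl⟩ : ∃ q, n = q + 2 := ⟨n - 2, by omega⟩
  rw [show q + 2 - 2 = q from rfl] at hk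
  rw [show q + 2 - 1 = q + 1 from rfl]
  choose hi hi_src hi_tgt hi_adj hi_lt using fun σ => exists_twin q σ 1 (Or.inl rfl)
  choose lo lo_src lo_tgt lo_adj lo_lt using fun σ => exists_twin q σ (-1) (Or.inr rfl)
  replace hi_lt : ∀ σ, hi σ 0 < hi σ (Fin.last _) := fun σ => (hi_lt σ).2 rfl
  replace lo_lt : ∀ σ, lo σ (Fin.last _) < lo σ 0 := fun σ =>
    lt_of_le_of_ne (not_lt.1 fun h => by simpa using (lo_lt σ).1 h)
      ((lo σ).injective.ne (Fin.last_pos).ne')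
  have pattern_inj : ∀ σ τ : Equiv.Perm (Fin (q + 1)),
      ((fun i j => σ i < σ j) = fun i j => τ i < τ j) → σ = τ := fun σ τ h =>
    perm_eq_of_lt_imp fun i j hij => (congrFun (congrFun h i) j).mpr hij
  have hi_inj : Function.Injective hi := fun σ τ h =>
    pattern_inj σ τ (by rw [← hi_src, ← hi_src, h])
  have lo_inj : Function.Injective lo := fun σ τ h =>
    pattern_inj σ τ (by rw [← lo_src, ← lo_src, h])
  have hi_lo : ∀ σ, srcPattern (hi σ) = srcPattern (lo σ) := fun σ => by rw [hi_src, lo_src]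
  obtain ⟨C, hC, hCrot⟩ := exists_invariant_perm_finset q k hk
  set R : Finset (Equiv.Perm (Fin (q + 2))) := C.image hi with hR
  have lo_notMem : ∀ σ, lo σ ∉ R := fun σ h => by
    obtain ⟨τ, -, h⟩ := Finset.mem_image.1 h
    exact lt_asymm (lo_lt σ) (h ▸ hi_lt τ)
  have hRcard : R.card = k * (q + 1) := by rw [hR, Finset.card_image_of_injective _ hi_inj, hC]
  have hcard : Fintype.card {π // π ∉ R} = (q + 2).factorial - k * (q + 1) := by
    rw [Fintype.card_subtype_compl, Fintype.card_perm, Fintype.card_fin, Fintype.card_coe, hRcard]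
  have hle : k * (q + 1) ≤ (q + 2).factorial :=
    calc k * (q + 1) ≤ q.factorial * (q + 1) := Nat.mul_le_mul_right _ hk
      _ = (q + 1).factorial := by rw [Nat.factorial_succ, mul_comm]
      _ ≤ (q + 2).factorial := Nat.factorial_le (by omega)
  have : Nonempty {π // π ∉ R} := ⟨⟨lo 1, lo_notMem 1⟩⟩
  have hrotR : ∃ g : Equiv.Perm (Equiv.Perm (Fin (q + 2))), (∀ a, g a ∈ R ↔ a ∈ R) ∧
      ∀ a ∈ R, srcPattern (g a) = tgtPattern a := by
    classical
    let g := (Equiv.mulRight (finRotate (q + 1))).extendDomain (Equiv.ofInjective hi hi_inj)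
    have hg : ∀ σ, g (hi σ) = hi (σ * finRotate (q + 1)) := fun σ =>
      Equiv.Perm.extendDomain_apply_image _ (Equiv.ofInjective hi hi_inj) σ
    refine ⟨g, fun a => ?_, fun a ha => ?_⟩
    · by_cases ha : a ∈ Set.range hi
      · obtain ⟨σ, rfl⟩ := ha
        rw [hg, hR, hi_inj.mem_finset_image, hi_inj.mem_finset_image, hCrot]
      · rw [show g a = a from Equiv.Perm.extendDomain_apply_not_subtype _ _ ha]
    · obtain ⟨σ, -, rfl⟩ := Finset.mem_image.1 ha
      rw [hg, hi_src, hi_tgt]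
      rfl
  obtain ⟨e, he, he_bij⟩ := exists_eulerian_circuit
    (fun e : {π // π ∉ R} => srcPattern e.1) (fun e => tgtPattern e.1)
    (card_fiber_compl_eq R srcPattern tgtPattern
      ⟨Equiv.mulRight (finRotate (q + 2)), srcPattern_mul_finRotate⟩ hrotR)
    (patterns_connected (fun π => π ∉ R) fun π => by
      by_cases h : π ∈ R
      · obtain ⟨σ, -, rfl⟩ := Finset.mem_image.1 h
        exact ⟨lo σ, lo_notMem σ, (hi_lo σ).symm, by rw [hi_tgt, lo_tgt]⟩
      · exact ⟨π, h, rfl, rfl⟩)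
  rw [hcard] at he_bij
  obtain ⟨x, hx⟩ := exists_rat_word (fun i => (e i).1) (fun i => ∃ σ ∈ C, lo σ = (e i).1) he
    (by rintro i ⟨σ, -, h⟩; exact h ▸ lo_adj σ)
  obtain ⟨w, hw_pos, hw⟩ := exists_pos_nat_word x ((q + 2).factorial + (q + 1) - k * (q + 1))
  refine ⟨w, fun i _ => hw_pos i, fun i j hij hj hwij => ?_, fun π => ?_⟩
  · by_contra! hlt
    have h0 : (0 : Fin (q + 2)) ≠ ⟨j - i, by omega⟩ := fun h => by
      have := congrArg Fin.val h
      simp only [Fin.val_zero] at this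
      omega
    have hx0 := (hx i).2 0 ⟨j - i, by omega⟩ (by
      rintro ⟨-, ⟨-, h⟩ | ⟨h, -⟩⟩
      · simp only [Fin.ext_iff, Fin.val_last] at h; omega
      · simp [Fin.ext_iff] at h)
    have hx1 := (hx i).2 ⟨j - i, by omega⟩ 0 (by
      rintro ⟨-, ⟨h, -⟩ | ⟨h, -⟩⟩ <;> (simp [Fin.ext_iff] at h; omega))
    simp only [Fin.val_zero, add_zero, show i + (j - i) = j by omega] at hx0 hx1
    rw [← hw i j (by omega) hj] at hx0
    rw [← hw j i hj (by omega)] at hx1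
    rcases lt_or_gt_of_ne ((e i).1.injective.ne h0) with h | h
    · exact absurd (hx0.2 h) (by omega)
    · exact absurd (hx1.2 h) (by omega)
  · have hrep : ∃ ρ : {π // π ∉ R}, ∀ i,
        (∀ j l : Fin (q + 2), x (i + j) < x (i + l) → π j < π l) ↔ e i = ρ := by
      have hcollapsed : ∀ i σ, σ ∈ C → lo σ = (e i).1 → ∀ j l : Fin (q + 2),
          x (i + j) < x (i + l) ↔
            ¬ (j = 0 ∧ l = Fin.last _ ∨ j = Fin.last _ ∧ l = 0) ∧ lo σ j < lo σ l := by
        intro i σ hσ h j l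
        by_cases hjl : j = 0 ∧ l = Fin.last _ ∨ j = Fin.last _ ∧ l = 0
        · have hx0 := (hx i).1 ⟨σ, hσ, h⟩
          refine iff_of_false ?_ fun h => h.1 hjl
          rcases hjl with ⟨rfl, rfl⟩ | ⟨rfl, rfl⟩ <;> simp [hx0]
        · rw [(hx i).2 j l fun h => hjl h.2, h]
          exact ⟨fun h => ⟨hjl, h⟩, fun h => h.2⟩
      have hext : ∀ i, (∀ j l : Fin (q + 2), x (i + j) < x (i + l) → π j < π l) ↔
          (e i).1 = π ∨ ∃ σ ∈ C, lo σ = (e i).1 ∧ hi σ = π := by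
        intro i
        by_cases hc : ∃ σ ∈ C, lo σ = (e i).1
        · obtain ⟨σ, hσ, h⟩ := hc
          simp only [hcollapsed i σ hσ h, ← h]
          constructor
          · intro hπ
            rcases lt_or_gt_of_ne (π.injective.ne (Fin.last_pos (n := q)).ne) with h0 | h0
            · refine Or.inr ⟨σ, hσ, rfl, (perm_eq_of_lt_imp fun j l hjl => ?_).symm⟩
              by_cases hends : j = 0 ∧ l = Fin.last _ ∨ j = Fin.last _ ∧ l = 0
              · rcases hends with ⟨rfl, rfl⟩ | ⟨rfl, rfl⟩
                · exact h0
                · exact absurd hjl (hi_lt σ).not_gt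
              · exact hπ j l ⟨hends,
                  ((hi_adj σ).lt_iff_lt (lo_adj σ) (hi_lo σ) j l hends).1 hjl⟩
            · refine Or.inl (perm_eq_of_lt_imp fun j l hjl => ?_).symm
              by_cases hends : j = 0 ∧ l = Fin.last _ ∨ j = Fin.last _ ∧ l = 0
              · rcases hends with ⟨rfl, rfl⟩ | ⟨rfl, rfl⟩
                · exact absurd hjl (lo_lt σ).not_gt
                · exact h0
              · exact hπ j l ⟨hends, hjl⟩
          · rintro (rfl | ⟨τ, -, hτ, rfl⟩) j l ⟨hends, hjl⟩
            · exact hjl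
            · rw [lo_inj hτ]
              exact ((hi_adj σ).lt_iff_lt (lo_adj σ) (hi_lo σ) j l hends).2 hjl
        · have hx' : ∀ j l : Fin (q + 2), x (i + j) < x (i + l) ↔ (e i).1 j < (e i).1 l :=
            fun j l => (hx i).2 j l fun h => hc h.1
          simp only [hx']
          constructor
          · exact fun h => Or.inl (perm_eq_of_lt_imp h).symm
          · rintro (h | ⟨σ, hσ, h, -⟩)
            · rw [h]; exact fun _ _ => id
            · exact absurd ⟨σ, hσ, h⟩ hc
      by_cases hπ : π ∈ R
      · obtain ⟨σ, hσ, h⟩ := Finset.mem_image.1 hπ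
        refine ⟨⟨lo σ, lo_notMem σ⟩, fun i => (hext i).trans ⟨?_, fun hi => ?_⟩⟩
        · rintro (h' | ⟨τ, -, h1, h2⟩)
          · exact absurd (h' ▸ hπ) (e i).2
          · rw [hi_inj (h.trans h2.symm)]; exact Subtype.ext h1.symm
        · exact Or.inr ⟨σ, hσ, by rw [hi], h⟩
      · refine ⟨⟨π, hπ⟩, fun i => (hext i).trans ⟨?_, fun hi => Or.inl (by rw [hi])⟩⟩
        rintro (h' | ⟨τ, hτ, -, h2⟩)
        · exact Subtype.ext h'
        · exact absurd (h2 ▸ Finset.mem_image_of_mem hi hτ) hπ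
    obtain ⟨ρ, hρ⟩ := hrep
    have hiff : ∀ i, (i + (q + 2) ≤ (q + 2).factorial + (q + 1) - k * (q + 1) ∧
        ∀ j l : Fin (q + 2), w (i + j) < w (i + l) → π j < π l) ↔
        i < (q + 2).factorial - k * (q + 1) ∧ e i = ρ := by
      intro i
      rw [show i + (q + 2) ≤ (q + 2).factorial + (q + 1) - k * (q + 1) ↔
        i < (q + 2).factorial - k * (q + 1) by omega]
      refine and_congr_right fun hi' => ?_
      rw [← hρ]
      refine forall₂_congr fun j l => ?_
      rw [hw _ _ (by omega) (by omega)]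
    simpa only [hiff] using he_bij ρ
end

section
/- Let n ≥ 3, let u = u₁u₂⋯u_N be a cyclic word of length N ≥ n over ℕ ∪ {◇} such that every permutation of {1,…,n} is covered by exactly one of its N cyclic length-n factors, let n−k be the common number of ◇s in each cyclic length-n factor of u, and let c = gcd(n,N). Then n/c divides n−k; in particular, if 1 ≤ k ≤ n−1 then c ≠ 1. -/
/-- A length-`n` factor `f` of a word over `ℕ ∪ {◇}` (with `none` playing the role
of `◇`) covers a permutation `π` of `{1,…,n}` if for all positions `j, l` holding
non-`◇` letters `a, b`, one has `a < b` iff `π j < π l`. -/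
def Covers (n : ℕ) (f : Fin n → Option ℕ) (π : Equiv.Perm (Fin n)) : Prop :=
  ∀ (j l : Fin n) (a b : ℕ), f j = some a → f l = some b → (a < b ↔ π j < π l)

/-- The cyclic word `u` of length `N` (given by its letters `u 0, …, u (N-1)`)
covers every permutation of `{1,…,n}` by exactly one of its `N` cyclic length-`n`
factors. -/
def CycUniversal (n N : ℕ) (u : ℕ → Option ℕ) : Prop :=
  ∀ π : Equiv.Perm (Fin n),
    ∃! i : ℕ, i < N ∧ Covers n (fun j => u ((i + (j : ℕ)) % N)) π

/-- The number of `◇`s in the cyclic length-`n` factor of `u` starting at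
position `i` (the word `u` being cyclic of length `N`). -/
def diaCount (n N : ℕ) (u : ℕ → Option ℕ) (i : ℕ) : ℕ :=
  (Finset.univ.filter fun j : Fin n => u ((i + (j : ℕ)) % N) = none).card

theorem Function.Periodic.nat_gcd {α : Type*} {g : ℕ → α} (a b : ℕ)
    (ha : Function.Periodic g a) (hb : Function.Periodic g b) :
    Function.Periodic g (Nat.gcd a b) := by
  induction a, b using Nat.gcd.induction with
  | H0 b => simpa using hb
  | H1 a b _ ih =>
    rw [Nat.gcd_rec]
    refine ih (fun x => ?_) ha
    have h := ha.nat_mul (b / a) (x + b % a)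
    rw [← h, ← hb x]
    congr 1
    have := Nat.mod_add_div b a
    push_cast
    linarith

theorem Function.Periodic.sum_range_mul {g : ℕ → ℕ} {c : ℕ}
    (hg : Function.Periodic g c) (m : ℕ) :
    ∑ j ∈ Finset.range (m * c), g j = m * ∑ j ∈ Finset.range c, g j := by
  induction m with
  | zero => simp
  | succ m ih =>
    rw [Nat.succ_mul, Finset.sum_range_add, ih, Nat.succ_mul]
    congr 1
    refine Finset.sum_congr rfl fun j _ => ?_
    rw [add_comm]
    exact hg.nat_mul m j

theorem periodic_of_sum_range_const {g : ℕ → ℕ} {n s : ℕ}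
    (h : ∀ i, ∑ j ∈ Finset.range n, g (i + j) = s) : Function.Periodic g n := by
  intro i
  have h₁ := Finset.sum_range_succ (fun j => g (i + j)) n
  have h₂ := Finset.sum_range_succ' (fun j => g (i + j)) n
  have h₃ := h (i + 1)
  simp only [add_assoc, add_comm 1] at h₃
  simp only [h, h₃, add_zero] at h₁ h₂
  omega

theorem diaCount_eq_sum (n N : ℕ) (u : ℕ → Option ℕ) (i : ℕ) :
    diaCount n N u i =
      ∑ j ∈ Finset.range n, if u ((i + j) % N) = none then 1 else 0 := by
  rw [diaCount, Finset.card_filter,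
    Fin.sum_univ_eq_sum_range (fun j => if u ((i + j) % N) = none then 1 else 0)]

theorem diaCount_mod (n N : ℕ) (u : ℕ → Option ℕ) (i : ℕ) :
    diaCount n N u (i % N) = diaCount n N u i := by
  simp [diaCount]

/-- Let `n ≥ 3`, let `u` be a cyclic word of length `N ≥ n` over `ℕ ∪ {◇}` such
that every permutation of `{1,…,n}` is covered by exactly one of its `N` cyclic
length-`n` factors, let `n - k` (with `k ≤ n`) be the common number of `◇`s in each
cyclic length-`n` factor of `u`, and let `c = gcd(n, N)`. Then `n/c` divides
`n - k`; in particular, if `1 ≤ k ≤ n - 1` then `c ≠ 1`. -/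
theorem stmt9 (n N : ℕ) (hn : 3 ≤ n) (hN : n ≤ N) (u : ℕ → Option ℕ)
    (hu : CycUniversal n N u) (k : ℕ) (hk : k ≤ n)
    (hcnt : ∀ i < N, diaCount n N u i = n - k) :
    (n / Nat.gcd n N) ∣ (n - k) ∧ (1 ≤ k → k ≤ n - 1 → Nat.gcd n N ≠ 1) := by
  have hdvd : (n / Nat.gcd n N) ∣ (n - k) := by
    set g : ℕ → ℕ := fun i => if u (i % N) = none then 1 else 0 with hg
    have hsum : ∀ i, ∑ j ∈ Finset.range n, g (i + j) = n - k := fun i => by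
      rw [← hcnt (i % N) (Nat.mod_lt _ (by omega)), diaCount_mod, diaCount_eq_sum]
    have hgN : Function.Periodic g N := fun i => by simp [hg]
    have hgc := Function.Periodic.nat_gcd n N (periodic_of_sum_range_const hsum) hgN
    have h := hgc.sum_range_mul (n / Nat.gcd n N)
    rw [Nat.div_mul_cancel (Nat.gcd_dvd_left n N)] at h
    have h₀ := hsum 0
    simp only [zero_add] at h₀
    exact ⟨_, h₀.symm.trans h⟩
  refine ⟨hdvd, fun h₁ h₂ hc => ?_⟩
  rw [hc, Nat.div_one] at hdvd
  have := Nat.le_of_dvd (by omega) hdvd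
  omega
end
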